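/- arXiv:0707.1113 — 3 statements merged into one kernel-verified Lean document; each statement's English description precedes it below -/
import Mathlib

section
/- Let J and J₁ be nonsingular J-tensors for the metric g on U, let σ₁ = det J₁, and let G₁ = σ₁ J₁ G be the equivalent contravariant metric, g₁ = G₁⁻¹, whose Christoffel symbols Γ^{(1)i}_{jk} satisfy the projective-equivalence relation Γ^i_{jk} = Γ^{(1)i}_{jk} + (1/(2σ₁))(δ^i_j ∂σ₁/∂q^k + δ^i_k ∂σ₁/∂q^j) on U. Suppose q : I → U is a smooth solution of the cofactor system d²q^i/dt² + Γ^i_{jk}(dq^j/dt)(dq^k/dt) = −((cof J)⁻¹∇V)^i, and let t₁ be a new parameter defined by a strictly monotone smooth τ : I → ℝ with dτ/dt = 1/σ₁(q(t)). Then the reparametrized curve q̂ = q ∘ τ⁻¹ satisfies d²q̂^i/dt₁² + Γ^{(1)i}_{jk}(dq̂^j/dt₁)(dq̂^k/dt₁) = −([cof(J J₁⁻¹)]⁻¹ ∇^{(1)}V)^i, where ∇^{(1)}V = G₁ dV, i.e. (∇^{(1)}V)^i = G₁^{ij}∂_j V. -/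
noncomputable section
open Matrix

/-- Partial derivative `∂f/∂q^i` of a scalar function on `ℝⁿ`. -/
def pd {n : ℕ} (f : (Fin n → ℝ) → ℝ) (i : Fin n) (q : Fin n → ℝ) : ℝ :=
  fderiv ℝ f q (Pi.single i 1)

/-- Christoffel symbols `Γ^i_{jk}` of a metric `g` (with `G = g⁻¹`). -/
def christoffel {n : ℕ} (g : (Fin n → ℝ) → Matrix (Fin n) (Fin n) ℝ)
    (i j k : Fin n) (q : Fin n → ℝ) : ℝ :=
  (1 / 2) * ∑ l, (g q)⁻¹ i l *
    (pd (fun q' => g q' l k) j q + pd (fun q' => g q' l j) k q - pd (fun q' => g q' j k) l q)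

/-- Gradient with respect to the metric `g`: `(∇V)^i = G^{ij} ∂_j V`. -/
def grad {n : ℕ} (g : (Fin n → ℝ) → Matrix (Fin n) (Fin n) ℝ)
    (V : (Fin n → ℝ) → ℝ) (q : Fin n → ℝ) : Fin n → ℝ :=
  (g q)⁻¹ *ᵥ (fun j => pd V j q)

/-- Covariant derivative `∇_h J^i_j` of a (1,1)-tensor field. -/
def covDeriv {n : ℕ} (g J : (Fin n → ℝ) → Matrix (Fin n) (Fin n) ℝ)
    (h i j : Fin n) (q : Fin n → ℝ) : ℝ :=
  pd (fun q' => J q' i j) h q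
    + ∑ l, christoffel g i h l q * J q l j
    - ∑ l, christoffel g l h j q * J q i l

/-- `J` is a J-tensor for the metric `g` on `U`: `JG` is symmetric and
`∇_h J^i_j = α_j δ^i_h + α^i g_{jh}` for some 1-form `α`. -/
def IsJTensor {n : ℕ} (U : Set (Fin n → ℝ))
    (g J : (Fin n → ℝ) → Matrix (Fin n) (Fin n) ℝ) : Prop :=
  (∀ i j, ContDiffOn ℝ (⊤ : ℕ∞) (fun q => J q i j) U) ∧
  (∀ q ∈ U, (J q * (g q)⁻¹).IsSymm) ∧
  ∃ α : (Fin n → ℝ) → (Fin n → ℝ), ∀ q ∈ U, ∀ h i j,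
    covDeriv g J h i j q =
      α q j * (if i = h then (1 : ℝ) else 0) + (∑ k, (g q)⁻¹ i k * α q k) * g q j h

/-- A field of matrices with differentiable entries has a differentiable determinant. -/
theorem differentiableAt_matrix_det {E : Type*} [NormedAddCommGroup E] [NormedSpace ℝ E] {n : ℕ}
    {A : E → Matrix (Fin n) (Fin n) ℝ} {x : E}
    (hA : ∀ i j, DifferentiableAt ℝ (fun y => A y i j) x) :
    DifferentiableAt ℝ (fun y => (A y).det) x := by
  simp only [Matrix.det_apply']
  exact DifferentiableAt.fun_sum fun p _ =>
    (HasFDerivAt.finsetProd fun i _ =>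
      (hA (p i) i).hasFDerivAt).differentiableAt.const_mul _

/-- The inverse of the cofactor matrix of a nonsingular matrix. -/
theorem inv_adjugate_of_det_ne_zero {n : ℕ} {A : Matrix (Fin n) (Fin n) ℝ} (hA : A.det ≠ 0) :
    (A.adjugate)⁻¹ = (A.det)⁻¹ • A := by
  apply Matrix.inv_eq_left_inv
  rw [Matrix.smul_mul, Matrix.mul_adjugate, smul_smul, inv_mul_cancel₀ hA, one_smul]

/-- The force of a cofactor system in terms of the metric `σ B G`, where `σ = det B`. -/
theorem inv_adjugate_mul_inv_mulVec {n : ℕ} {A B : Matrix (Fin n) (Fin n) ℝ}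
    (hA : A.det ≠ 0) (hB : B.det ≠ 0) (G : Matrix (Fin n) (Fin n) ℝ) (v : Fin n → ℝ) :
    ((A * B⁻¹).adjugate)⁻¹ *ᵥ ((B.det • (B * G)) *ᵥ v)
      = B.det ^ 2 • ((A.adjugate)⁻¹ *ᵥ (G *ᵥ v)) := by
  have hBi : (B⁻¹).det = (B.det)⁻¹ := by rw [Matrix.det_nonsing_inv, Ring.inverse_eq_inv']
  have hAB : (A * B⁻¹).det ≠ 0 := by
    rw [Matrix.det_mul, hBi]
    exact mul_ne_zero hA (inv_ne_zero hB)
  rw [inv_adjugate_of_det_ne_zero hAB, inv_adjugate_of_det_ne_zero hA, Matrix.mulVec_mulVec,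
    Matrix.mulVec_mulVec, ← Matrix.smul_mulVec, Matrix.det_mul, hBi]
  congr 1
  rw [Matrix.smul_mul, Matrix.mul_smul, smul_smul, Matrix.mul_assoc,
    ← Matrix.mul_assoc B⁻¹, Matrix.nonsing_inv_mul _ (isUnit_iff_ne_zero.mpr hB), Matrix.one_mul,
    Matrix.smul_mul, smul_smul]
  congr 1
  field_simp

/-- Chain rule along a curve, in terms of partial derivatives. -/
theorem hasDerivAt_comp_sum_pd {n : ℕ} {f : (Fin n → ℝ) → ℝ} {c : ℝ → Fin n → ℝ}
    {v : Fin n → ℝ} {t : ℝ} (hf : DifferentiableAt ℝ f (c t))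
    (hc : ∀ i, HasDerivAt (fun u => c u i) (v i) t) :
    HasDerivAt (fun u => f (c u)) (∑ k, v k * pd f k (c t)) t := by
  have h := hf.hasFDerivAt.comp_hasDerivAt t (hasDerivAt_pi.mpr hc)
  have he : fderiv ℝ f (c t) v = ∑ k, v k * pd f k (c t) := by
    have h' := LinearMap.pi_apply_eq_sum_univ (fderiv ℝ f (c t)).toLinearMap v
    have hs : ∀ k : Fin n, (fun j => if k = j then (1 : ℝ) else 0) = Pi.single k 1 := fun k => by
      ext j
      simp [Pi.single_apply, eq_comm]
    simpa [hs, pd] using h'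
  rw [← he]
  exact h

/-- Evaluation of projectively equivalent connection coefficients on a velocity vector. -/
theorem sum_sum_projective {n : ℕ} {Γ Γ' : Fin n → Fin n → ℝ} {d v : Fin n → ℝ} {a : ℝ}
    (i : Fin n)
    (h : ∀ j k, Γ j k = Γ' j k + (1 / (2 * a)) * ((if i = j then (1 : ℝ) else 0) * d k
      + (if i = k then (1 : ℝ) else 0) * d j)) :
    ∑ j, ∑ k, Γ j k * v j * v k
      = ∑ j, ∑ k, Γ' j k * v j * v k + a⁻¹ * v i * ∑ k, v k * d k := by
  have h₁ : ∑ j, ∑ k, (if i = j then (1 : ℝ) else 0) * d k * v j * v k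
      = v i * ∑ k, v k * d k := by
    simp [ite_mul, Finset.sum_ite_irrel, Finset.mul_sum]
    exact Finset.sum_congr rfl fun k _ => by ring
  have h₂ : ∑ j, ∑ k, (if i = k then (1 : ℝ) else 0) * d j * v j * v k
      = v i * ∑ k, v k * d k := by
    simp [ite_mul, Finset.mul_sum]
    exact Finset.sum_congr rfl fun k _ => by ring
  have h₃ : ∑ j, ∑ k, Γ j k * v j * v k = ∑ j, ∑ k, Γ' j k * v j * v k
      + (1 / (2 * a)) * (∑ j, ∑ k, (if i = j then (1 : ℝ) else 0) * d k * v j * v k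
        + ∑ j, ∑ k, (if i = k then (1 : ℝ) else 0) * d j * v j * v k) := by
    simp only [mul_add, Finset.mul_sum, ← Finset.sum_add_distrib]
    exact Finset.sum_congr rfl fun j _ => Finset.sum_congr rfl fun k _ => by rw [h]; ring
  rw [h₃, h₁, h₂]
  field_simp
  ring

/-- A left inverse of a map with nonzero derivative on an open set is differentiable on the image,
which is a neighbourhood of each of its points. -/
theorem image_mem_nhds_and_hasDerivAt_leftInverse {τ θ : ℝ → ℝ} {I : Set ℝ} (hI : IsOpen I)
    (hτ : ContDiffOn ℝ (⊤ : ℕ∞) τ I) (hθ : ∀ t ∈ I, θ (τ t) = t) {t : ℝ} (ht : t ∈ I)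
    (h0 : deriv τ t ≠ 0) :
    τ '' I ∈ nhds (τ t) ∧ HasDerivAt θ (deriv τ t)⁻¹ (τ t) := by
  have hs : HasStrictDerivAt τ (deriv τ t) t :=
    (hτ.contDiffAt (hI.mem_nhds ht)).hasStrictDerivAt (by simp)
  constructor
  · rw [← hs.map_nhds_eq h0]
    exact Filter.image_mem_map (hI.mem_nhds ht)
  · exact (hs.to_local_left_inverse h0
      (Filter.eventually_of_mem (hI.mem_nhds ht) hθ)).hasDerivAt

/-- A cofactor system transforms, under the reciprocal
transformation `dτ/dt = 1/σ₁`, into the cofactor system of the geodesically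
equivalent metric `G₁ = σ₁ J₁ G`, with J-tensor `J J₁⁻¹`. -/
theorem cofactor_reciprocal_transformation
    (n : ℕ) (U : Set (Fin n → ℝ)) (hU : IsOpen U)
    (g : (Fin n → ℝ) → Matrix (Fin n) (Fin n) ℝ)
    (hg : ∀ i j, ContDiffOn ℝ (⊤ : ℕ∞) (fun q => g q i j) U)
    (hgsym : ∀ q ∈ U, (g q).IsSymm) (hginv : ∀ q ∈ U, IsUnit (g q).det)
    (J J₁ : (Fin n → ℝ) → Matrix (Fin n) (Fin n) ℝ)
    (hJ : IsJTensor U g J) (hJ₁ : IsJTensor U g J₁)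
    (hJns : ∀ q ∈ U, (J q).det ≠ 0) (hJ₁ns : ∀ q ∈ U, (J₁ q).det ≠ 0)
    (σ₁ : (Fin n → ℝ) → ℝ) (hσ₁ : σ₁ = fun q => (J₁ q).det)
    (G₁ g₁ : (Fin n → ℝ) → Matrix (Fin n) (Fin n) ℝ)
    (hG₁ : G₁ = fun q => σ₁ q • (J₁ q * (g q)⁻¹))
    (hg₁ : g₁ = fun q => (G₁ q)⁻¹)
    -- the projective-equivalence relation between the Christoffel symbols of g and g₁
    (hproj : ∀ q ∈ U, ∀ i j k : Fin n,
      christoffel g i j k q = christoffel g₁ i j k q +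
        (1 / (2 * σ₁ q)) * ((if i = j then (1 : ℝ) else 0) * pd σ₁ k q
          + (if i = k then (1 : ℝ) else 0) * pd σ₁ j q))
    (V : (Fin n → ℝ) → ℝ) (hV : ContDiffOn ℝ (⊤ : ℕ∞) V U)
    -- a smooth solution c of the cofactor system on an open interval I
    (I : Set ℝ) (hI : IsOpen I)
    (c : ℝ → (Fin n → ℝ)) (hc : ∀ i, ContDiffOn ℝ (⊤ : ℕ∞) (fun t => c t i) I)
    (hcU : ∀ t ∈ I, c t ∈ U)
    (hODE : ∀ t ∈ I, ∀ i,
      deriv (fun s => deriv (fun u => c u i) s) t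
        + ∑ j, ∑ k, christoffel g i j k (c t)
            * deriv (fun u => c u j) t * deriv (fun u => c u k) t
      = - (((J (c t)).adjugate)⁻¹ *ᵥ grad g V (c t)) i)
    -- the reparametrization τ with dτ/dt = 1/σ₁(c t), and its inverse θ
    (τ θ : ℝ → ℝ) (hτsmooth : ContDiffOn ℝ (⊤ : ℕ∞) τ I) (hτmono : StrictMonoOn τ I)
    (hτ' : ∀ t ∈ I, deriv τ t = 1 / σ₁ (c t))
    (hθ : ∀ t ∈ I, θ (τ t) = t)
    (qh : ℝ → (Fin n → ℝ)) (hqh : qh = c ∘ θ) :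
    ∀ s ∈ τ '' I, ∀ i,
      deriv (fun u => deriv (fun w => qh w i) u) s
        + ∑ j, ∑ k, christoffel g₁ i j k (qh s)
            * deriv (fun w => qh w j) s * deriv (fun w => qh w k) s
      = - (((J (qh s) * (J₁ (qh s))⁻¹).adjugate)⁻¹ *ᵥ
            (G₁ (qh s) *ᵥ (fun j => pd V j (qh s)))) i := by
  rintro _ ⟨t, ht, rfl⟩ i
  have hσne : ∀ t ∈ I, σ₁ (c t) ≠ 0 := fun t ht => by
    rw [hσ₁]
    exact hJ₁ns _ (hcU t ht)
  have hθ' : ∀ t ∈ I, τ '' I ∈ nhds (τ t) ∧ HasDerivAt θ (σ₁ (c t)) (τ t) := fun t ht => by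
    have h := image_mem_nhds_and_hasDerivAt_leftInverse hI hτsmooth hθ ht
      (by rw [hτ' t ht]; exact one_div_ne_zero (hσne t ht))
    simpa [hτ' t ht] using h
  have hc₁ : ∀ t ∈ I, ∀ j, HasDerivAt (fun u => c u j) (deriv (fun u => c u j) t) t :=
    fun t ht j => (((hc j).contDiffAt (hI.mem_nhds ht)).differentiableAt (by simp)).hasDerivAt
  have hc₂ : HasDerivAt (fun s => deriv (fun u => c u i) s)
      (deriv (fun s => deriv (fun u => c u i) s) t) t :=
    ((((hc i).deriv_of_isOpen (m := (⊤ : ℕ∞)) hI le_rfl).contDiffAt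
      (hI.mem_nhds ht)).differentiableAt (by simp)).hasDerivAt
  have hσd : DifferentiableAt ℝ σ₁ (c t) := by
    rw [hσ₁]
    exact differentiableAt_matrix_det fun i j =>
      ((hJ₁.1 i j).contDiffAt (hU.mem_nhds (hcU t ht))).differentiableAt (by simp)
  have hq₁ : ∀ t ∈ I, ∀ j, HasDerivAt (fun w => qh w j)
      (deriv (fun u => c u j) t * σ₁ (c t)) (τ t) := fun t ht j => by
    rw [hqh]
    exact HasDerivAt.comp (h₂ := fun u => c u j) (τ t) (by rw [hθ t ht]; exact hc₁ t ht j)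
      (hθ' t ht).2
  have hq₂ : HasDerivAt (fun u => deriv (fun w => qh w i) u)
      ((deriv (fun s => deriv (fun u => c u i) s) t * σ₁ (c t)
        + deriv (fun u => c u i) t * ∑ k, deriv (fun u => c u k) t * pd σ₁ k (c t))
          * σ₁ (c t)) (τ t) := by
    have h := hc₂.mul (hasDerivAt_comp_sum_pd hσd (hc₁ t ht))
    rw [← hθ t ht] at h
    have h' := HasDerivAt.comp (τ t) h (hθ' t ht).2
    rw [hθ t ht] at h'
    refine h'.congr_of_eventuallyEq ?_
    filter_upwards [(hθ' t ht).1]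
    rintro _ ⟨r, hr, rfl⟩
    simp [(hq₁ r hr i).deriv, hθ r hr]
  have hqt : qh (τ t) = c t := by simp [hqh, hθ t ht]
  have hforce := congrFun (inv_adjugate_mul_inv_mulVec (hJns _ (hcU t ht)) (hJ₁ns _ (hcU t ht))
    (g (c t))⁻¹ (fun j => pd V j (c t))) i
  have hΓ := sum_sum_projective (v := fun j => deriv (fun u => c u j) t) i
    (hproj _ (hcU t ht) i)
  have hode := hODE t ht i
  have hσt : (J₁ (c t)).det = σ₁ (c t) := by rw [hσ₁]
  rw [hσt, Pi.smul_apply, smul_eq_mul] at hforce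
  have hG : G₁ (c t) = σ₁ (c t) • (J₁ (c t) * (g (c t))⁻¹) := by rw [hG₁]
  have hscale : ∑ j, ∑ k, christoffel g₁ i j k (c t)
        * (deriv (fun u => c u j) t * σ₁ (c t)) * (deriv (fun u => c u k) t * σ₁ (c t))
      = σ₁ (c t) ^ 2 * ∑ j, ∑ k, christoffel g₁ i j k (c t)
        * deriv (fun u => c u j) t * deriv (fun u => c u k) t := by
    simp only [Finset.mul_sum]
    exact Finset.sum_congr rfl fun j _ => Finset.sum_congr rfl fun k _ => by ring
  rw [hq₂.deriv, hqt, hG, hforce]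
  simp only [(hq₁ t ht _).deriv]
  rw [hscale]
  rw [hΓ] at hode
  unfold grad at hode
  have hne := hσne t ht
  field_simp at hode
  linear_combination σ₁ (c t) * hode
end
end

section
/- Let J₁, J₂ and J₃ be nonsingular J-tensors for the metric g on U, let V, W : U → ℝ be smooth potentials satisfying the bi-cofactor condition (cof J₁)⁻¹∇V = (cof J₂)⁻¹∇W on U, let σ₃ = det J₃, and let G₃ = σ₃ J₃ G be the equivalent contravariant metric whose Christoffel symbols Γ^{(3)i}_{jk} satisfy Γ^i_{jk} = Γ^{(3)i}_{jk} + (1/(2σ₃))(δ^i_j ∂σ₃/∂q^k + δ^i_k ∂σ₃/∂q^j) on U. Suppose q : I → U solves d²q^i/dt² + Γ^i_{jk}(dq^j/dt)(dq^k/dt) = −((cof J₁)⁻¹∇V)^i, and let t₃ be defined by a strictly monotone smooth τ with dτ/dt = 1/σ₃(q(t)). Then q̂ = q ∘ τ⁻¹ satisfies both d²q̂^i/dt₃² + Γ^{(3)i}_{jk}(dq̂^j/dt₃)(dq̂^k/dt₃) = −([cof(J₁ J₃⁻¹)]⁻¹ ∇^{(3)}V)^i and d²q̂^i/dt₃² +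 Γ^{(3)i}_{jk}(dq̂^j/dt₃)(dq̂^k/dt₃) = −([cof(J₂ J₃⁻¹)]⁻¹ ∇^{(3)}W)^i, where (∇^{(3)}f)^i = G₃^{ij}∂_j f. -/
noncomputable section
open Matrix

theorem Matrix.inv_adjugate_mul_inv {n : Type*} [Fintype n] [DecidableEq n]
    {A B : Matrix n n ℝ} (hB : B.det ≠ 0) :
    (A * B⁻¹).adjugate⁻¹ * (B.det • B) = B.det ^ 2 • A.adjugate⁻¹ := by
  have hu : IsUnit B.det := isUnit_iff_ne_zero.2 hB
  have hadj : B⁻¹.adjugate⁻¹ = B.det • B⁻¹ := by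
    refine Matrix.inv_eq_left_inv ?_
    have hdet : (B⁻¹).det = B.det⁻¹ := by
      rw [Matrix.det_nonsing_inv, Ring.inverse_eq_inv']
    rw [Matrix.smul_mul, Matrix.mul_adjugate, hdet, smul_smul, mul_inv_cancel₀ hB, one_smul]
  rw [Matrix.adjugate_mul_distrib, Matrix.mul_inv_rev, hadj, Matrix.mul_smul, Matrix.mul_smul,
    Matrix.smul_mul, Matrix.mul_assoc, Matrix.nonsing_inv_mul _ hu, Matrix.mul_one, smul_smul, sq]

theorem Matrix.differentiableAt_det {n : Type*} [Fintype n] [DecidableEq n]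
    {E : Type*} [NormedAddCommGroup E] [NormedSpace ℝ E] {A : E → Matrix n n ℝ} {x : E}
    (hA : ∀ i j, DifferentiableAt ℝ (fun y => A y i j) x) :
    DifferentiableAt ℝ (fun y => (A y).det) x := by
  simp only [Matrix.det_apply']
  fun_prop

theorem fderiv_apply_eq_sum_pd {n : ℕ} (f : (Fin n → ℝ) → ℝ) (q v : Fin n → ℝ) :
    fderiv ℝ f q v = ∑ k, pd f k q * v k := by
  have h := (fderiv ℝ f q).toLinearMap.pi_apply_eq_sum_univ v
  simp only [ContinuousLinearMap.coe_coe, smul_eq_mul] at h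
  rw [h]
  refine Finset.sum_congr rfl fun k _ => ?_
  have hk : (Pi.single k 1 : Fin n → ℝ) = fun j => if k = j then 1 else 0 := by
    ext j
    simp [Pi.single_apply, eq_comm]
  rw [pd, hk, mul_comm]

open scoped Topology in
/-- The acceleration of a curve after a change of parameter `dτ/dt = 1/σ`. -/
theorem deriv_deriv_comp_of_deriv_eq_inv {I : Set ℝ} (hI : IsOpen I) {x σ τ θ : ℝ → ℝ}
    (hx : ContDiffOn ℝ (⊤ : ℕ∞) x I) (hτ : ContDiffOn ℝ (⊤ : ℕ∞) τ I)
    (hτ' : ∀ t ∈ I, deriv τ t = 1 / σ t) (hσ₀ : ∀ t ∈ I, σ t ≠ 0)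
    (hθ : ∀ t ∈ I, θ (τ t) = t) {t σ' : ℝ} (ht : t ∈ I) (hσ : HasDerivAt σ σ' t) :
    deriv (fun w => x (θ w)) (τ t) = deriv x t * σ t ∧
      deriv (fun u => deriv (fun w => x (θ w)) u) (τ t) =
        σ t ^ 2 * deriv (fun u => deriv x u) t + σ t * deriv x t * σ' := by
  have hnhds : ∀ a ∈ I, I ∈ 𝓝 a := fun a ha => hI.mem_nhds ha
  have hstrict : ∀ a ∈ I, HasStrictDerivAt τ (1 / σ a) a := fun a ha => by
    rw [← hτ' a ha]
    exact (hτ.contDiffAt (hnhds a ha)).hasStrictDerivAt (by simp)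
  have hne : ∀ a ∈ I, 1 / σ a ≠ 0 := fun a ha => one_div_ne_zero (hσ₀ a ha)
  have hθ' : ∀ a ∈ I, HasDerivAt θ (σ a) (τ a) := fun a ha => by
    have h := ((hstrict a ha).to_local_left_inverse (hne a ha)
      (Filter.eventually_of_mem (hnhds a ha) hθ)).hasDerivAt
    simpa using h
  have hfirst : ∀ a ∈ I, HasDerivAt (fun w => x (θ w)) (deriv x a * σ a) (τ a) := fun a ha => by
    have hxa : HasDerivAt x (deriv x a) (θ (τ a)) := by
      rw [hθ a ha]
      exact ((hx.contDiffAt (hnhds a ha)).differentiableAt (by simp)).hasDerivAt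
    exact hxa.comp (τ a) (hθ' a ha)
  refine ⟨(hfirst t ht).deriv, ?_⟩
  have himage : τ '' I ∈ 𝓝 (τ t) := by
    rw [← (hstrict t ht).map_nhds_eq (hne t ht)]
    exact Filter.image_mem_map (hnhds t ht)
  have hev : (fun u => deriv (fun w => x (θ w)) u) =ᶠ[𝓝 (τ t)]
      fun u => deriv x (θ u) * σ (θ u) := by
    filter_upwards [himage]
    rintro _ ⟨a, ha, rfl⟩
    rw [hθ a ha, (hfirst a ha).deriv]
  have hx' : HasDerivAt (deriv x) (deriv (deriv x) t) t := by
    have h : ContDiffOn ℝ 1 (deriv x) I := hx.deriv_of_isOpen hI (by norm_cast)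
    exact ((h.contDiffAt (hnhds t ht)).differentiableAt (by simp)).hasDerivAt
  have hprod : HasDerivAt (fun a => deriv x a * σ a)
      (deriv (deriv x) t * σ t + deriv x t * σ') (θ (τ t)) := by
    rw [hθ t ht]
    exact hx'.mul hσ
  rw [hev.deriv_eq]
  refine (hprod.comp (τ t) (hθ' t ht)).deriv.trans ?_
  ring

/-- The quadratic forms of two projectively equivalent connections, in rescaled velocities. -/
theorem sum_projective_change {n : ℕ} (i : Fin n) (Γ Γ' : Fin n → Fin n → ℝ) (p v : Fin n → ℝ)
    {σ : ℝ} (hσ : σ ≠ 0)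
    (h : ∀ j k, Γ j k = Γ' j k + (1 / (2 * σ)) * ((if i = j then (1 : ℝ) else 0) * p k
      + (if i = k then (1 : ℝ) else 0) * p j)) :
    ∑ j, ∑ k, Γ' j k * (v j * σ) * (v k * σ) =
      σ ^ 2 * ∑ j, ∑ k, Γ j k * v j * v k - σ * v i * ∑ k, p k * v k := by
  have hterm : ∀ j k, Γ' j k * (v j * σ) * (v k * σ) = σ ^ 2 * (Γ j k * v j * v k)
      - (σ / 2) * ((if i = j then v j else 0) * (p k * v k)
        + (if i = k then v k else 0) * (p j * v j)) := fun j k => by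
    rw [h j k]
    split_ifs <;> field_simp <;> ring
  simp only [hterm, Finset.sum_sub_distrib, ← Finset.mul_sum, Finset.sum_add_distrib,
    ← Finset.sum_mul, Finset.sum_ite_eq, Finset.mem_univ, if_true]
  ring

/-- A bi-cofactor system transforms, under the reciprocal
transformation `dτ/dt = 1/σ₃`, into a bi-cofactor system for the geodesically
equivalent metric `G₃ = σ₃ J₃ G`, with J-tensors `J₁ J₃⁻¹` and `J₂ J₃⁻¹`. -/
theorem bicofactor_reciprocal_transformation
    (n : ℕ) (U : Set (Fin n → ℝ)) (hU : IsOpen U)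
    (g : (Fin n → ℝ) → Matrix (Fin n) (Fin n) ℝ)
    (hg : ∀ i j, ContDiffOn ℝ (⊤ : ℕ∞) (fun q => g q i j) U)
    (hgsym : ∀ q ∈ U, (g q).IsSymm) (hginv : ∀ q ∈ U, IsUnit (g q).det)
    (J₁ J₂ J₃ : (Fin n → ℝ) → Matrix (Fin n) (Fin n) ℝ)
    (hJ₁ : IsJTensor U g J₁) (hJ₂ : IsJTensor U g J₂) (hJ₃ : IsJTensor U g J₃)
    (hJ₁ns : ∀ q ∈ U, (J₁ q).det ≠ 0) (hJ₂ns : ∀ q ∈ U, (J₂ q).det ≠ 0)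
    (hJ₃ns : ∀ q ∈ U, (J₃ q).det ≠ 0)
    (V W : (Fin n → ℝ) → ℝ) (hV : ContDiffOn ℝ (⊤ : ℕ∞) V U) (hW : ContDiffOn ℝ (⊤ : ℕ∞) W U)
    -- the bi-cofactor condition
    (hbi : ∀ q ∈ U,
      ((J₁ q).adjugate)⁻¹ *ᵥ grad g V q = ((J₂ q).adjugate)⁻¹ *ᵥ grad g W q)
    (σ₃ : (Fin n → ℝ) → ℝ) (hσ₃ : σ₃ = fun q => (J₃ q).det)
    (G₃ g₃ : (Fin n → ℝ) → Matrix (Fin n) (Fin n) ℝ)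
    (hG₃ : G₃ = fun q => σ₃ q • (J₃ q * (g q)⁻¹))
    (hg₃ : g₃ = fun q => (G₃ q)⁻¹)
    -- the projective-equivalence relation between the Christoffel symbols of g and g₃
    (hproj : ∀ q ∈ U, ∀ i j k : Fin n,
      christoffel g i j k q = christoffel g₃ i j k q +
        (1 / (2 * σ₃ q)) * ((if i = j then (1 : ℝ) else 0) * pd σ₃ k q
          + (if i = k then (1 : ℝ) else 0) * pd σ₃ j q))
    -- a smooth solution c of the bi-cofactor system on an open interval I
    (I : Set ℝ) (hI : IsOpen I)
    (c : ℝ → (Fin n → ℝ)) (hc : ∀ i, ContDiffOn ℝ (⊤ : ℕ∞) (fun t => c t i) I)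
    (hcU : ∀ t ∈ I, c t ∈ U)
    (hODE : ∀ t ∈ I, ∀ i,
      deriv (fun s => deriv (fun u => c u i) s) t
        + ∑ j, ∑ k, christoffel g i j k (c t)
            * deriv (fun u => c u j) t * deriv (fun u => c u k) t
      = - (((J₁ (c t)).adjugate)⁻¹ *ᵥ grad g V (c t)) i)
    -- the reparametrization τ with dτ/dt = 1/σ₃(c t), and its inverse θ
    (τ θ : ℝ → ℝ) (hτsmooth : ContDiffOn ℝ (⊤ : ℕ∞) τ I) (hτmono : StrictMonoOn τ I)
    (hτ' : ∀ t ∈ I, deriv τ t = 1 / σ₃ (c t))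
    (hθ : ∀ t ∈ I, θ (τ t) = t)
    (qh : ℝ → (Fin n → ℝ)) (hqh : qh = c ∘ θ) :
    ∀ s ∈ τ '' I, ∀ i,
      (deriv (fun u => deriv (fun w => qh w i) u) s
        + ∑ j, ∑ k, christoffel g₃ i j k (qh s)
            * deriv (fun w => qh w j) s * deriv (fun w => qh w k) s
      = - (((J₁ (qh s) * (J₃ (qh s))⁻¹).adjugate)⁻¹ *ᵥ
            (G₃ (qh s) *ᵥ (fun j => pd V j (qh s)))) i)
      ∧
      (deriv (fun u => deriv (fun w => qh w i) u) s
        + ∑ j, ∑ k, christoffel g₃ i j k (qh s)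
            * deriv (fun w => qh w j) s * deriv (fun w => qh w k) s
      = - (((J₂ (qh s) * (J₃ (qh s))⁻¹).adjugate)⁻¹ *ᵥ
            (G₃ (qh s) *ᵥ (fun j => pd W j (qh s)))) i) := by
  rintro _ ⟨t, ht, rfl⟩ i
  have hq : qh (τ t) = c t := by simp [hqh, hθ t ht]
  have hcomp : ∀ j, (fun w => qh w j) = fun w => c (θ w) j := fun j => by simp [hqh]
  have hσne : ∀ a ∈ I, σ₃ (c a) ≠ 0 := fun a ha => by
    rw [hσ₃]
    exact hJ₃ns _ (hcU a ha)
  have hσdiff : DifferentiableAt ℝ σ₃ (c t) := by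
    rw [hσ₃]
    exact Matrix.differentiableAt_det fun i j =>
      ((hJ₃.1 i j).contDiffAt (hU.mem_nhds (hcU t ht))).differentiableAt (by simp)
  have hcderiv : HasDerivAt c (fun j => deriv (fun u => c u j) t) t :=
    hasDerivAt_pi.2 fun j =>
      (((hc j).contDiffAt (hI.mem_nhds ht)).differentiableAt (by simp)).hasDerivAt
  have hσderiv : HasDerivAt (fun a => σ₃ (c a))
      (∑ k, pd σ₃ k (c t) * deriv (fun u => c u k) t) t := by
    rw [← fderiv_apply_eq_sum_pd σ₃ (c t) (fun k => deriv (fun u => c u k) t)]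
    exact hσdiff.hasFDerivAt.comp_hasDerivAt t hcderiv
  have hreparam := fun j =>
    deriv_deriv_comp_of_deriv_eq_inv hI (hc j) hτsmooth hτ' hσne hθ ht hσderiv
  have hforce : ∀ (J : (Fin n → ℝ) → Matrix (Fin n) (Fin n) ℝ) (F : (Fin n → ℝ) → ℝ),
      ((J (c t) * (J₃ (c t))⁻¹).adjugate)⁻¹ *ᵥ (G₃ (c t) *ᵥ (fun j => pd F j (c t))) =
        σ₃ (c t) ^ 2 • (((J (c t)).adjugate)⁻¹ *ᵥ grad g F (c t)) := fun J F => by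
    have hdet : σ₃ (c t) = (J₃ (c t)).det := by rw [hσ₃]
    rw [hG₃, grad]
    simp only [hdet]
    rw [← Matrix.smul_mul, ← Matrix.mulVec_mulVec, Matrix.mulVec_mulVec,
      Matrix.inv_adjugate_mul_inv (hJ₃ns _ (hcU t ht)), Matrix.smul_mulVec]
  have hODE₃ : deriv (fun u => deriv (fun w => qh w i) u) (τ t)
        + ∑ j, ∑ k, christoffel g₃ i j k (c t)
            * deriv (fun w => qh w j) (τ t) * deriv (fun w => qh w k) (τ t)
      = -(σ₃ (c t) ^ 2 * (((J₁ (c t)).adjugate)⁻¹ *ᵥ grad g V (c t)) i) := by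
    simp only [hcomp, (hreparam _).1, (hreparam i).2]
    rw [sum_projective_change i (fun j k => christoffel g i j k (c t))
      (fun j k => christoffel g₃ i j k (c t)) (fun k => pd σ₃ k (c t))
      (fun k => deriv (fun u => c u k) t) (hσne t ht) (hproj (c t) (hcU t ht) i)]
    linear_combination σ₃ (c t) ^ 2 * hODE t ht i
  rw [hq, hforce, hforce, ← hbi (c t) (hcU t ht)]
  exact ⟨hODE₃, hODE₃⟩
end
end

section
/- Let J₁, J₂ be nonsingular J-tensors for the metric g on U with σ₁ = det J₁, let V, W : U → ℝ be smooth with the bi-cofactor condition (cof J₁)⁻¹∇V = (cof J₂)⁻¹∇W, and define matrices K₁(q), …, Kₙ(q) by the polynomial expansion cof(J₂(q) + ξ J₁(q)) = Σ_{i=0}^{n−1} K_{n−i}(q) ξ^i (valid for all ξ ∈ ℝ), so that K₁ = cof J₁ and Kₙ = cof J₂. Let V₁ = V, and let V₂, …, Vₙ : U → ℝ be smooth functions satisfying ∇V_r = (1/σ₁) K_r J₁ ∇V₁ for r = 1, …, n. Then each function H_r(q,p) = (1/2)pᵀ K_r(q) G(q) p + V_r(q) is a constant of motion of the system d(q,p)/dt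 = (1/σ₁) Π_nc(J₁) dH₁, i.e. H_r is constant along every solution of this first-order system. -/
noncomputable section
open Matrix

/-- The matrix `Ω^i_j = (∂J^k_i/∂q^j − ∂J^k_j/∂q^i) p_k` appearing in the
lower-right block of the noncanonical Poisson operator `Π_nc(J)`. -/
def Omega {n : ℕ} (J : (Fin n → ℝ) → Matrix (Fin n) (Fin n) ℝ)
    (q p : Fin n → ℝ) (i j : Fin n) : ℝ :=
  ∑ k, (pd (fun q' => J q' k i) j q - pd (fun q' => J q' k j) i q) * p k

/-- All entries of the matrix field `M` are differentiable at `q`. -/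
def DiffEntries {n : ℕ} (M : (Fin n → ℝ) → Matrix (Fin n) (Fin n) ℝ) (q : Fin n → ℝ) : Prop :=
  ∀ i j, DifferentiableAt ℝ (fun x => M x i j) q

/-- Entrywise partial derivative of a matrix field in the direction `h`. -/
def pdMat {n : ℕ} (M : (Fin n → ℝ) → Matrix (Fin n) (Fin n) ℝ) (h : Fin n) (q : Fin n → ℝ) :
    Matrix (Fin n) (Fin n) ℝ :=
  Matrix.of fun i j => pd (fun x => M x i j) h q

section MatrixFields

variable {n : ℕ} {M N : (Fin n → ℝ) → Matrix (Fin n) (Fin n) ℝ} {q : Fin n → ℝ}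

theorem pd_congr {f f' : (Fin n → ℝ) → ℝ} (hff' : f =ᶠ[nhds q] f') (h : Fin n) :
    pd f h q = pd f' h q := by
  simp only [pd, hff'.fderiv_eq]

theorem pdMat_congr (hMN : M =ᶠ[nhds q] N) (h : Fin n) : pdMat M h q = pdMat N h q := by
  ext i j
  exact pd_congr (hMN.mono fun x hx => by simp only [hx]) h

theorem DiffEntries.congr (hN : DiffEntries N q) (hMN : M =ᶠ[nhds q] N) : DiffEntries M q :=
  fun i j => (hN i j).congr_of_eventuallyEq (hMN.mono fun x hx => by simp only [hx])

theorem pdMat_const (A : Matrix (Fin n) (Fin n) ℝ) (h : Fin n) : pdMat (fun _ => A) h q = 0 := by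
  ext i j
  simp [pdMat, pd]

theorem DiffEntries.mul (hM : DiffEntries M q) (hN : DiffEntries N q) :
    DiffEntries (fun x => M x * N x) q := by
  intro i j
  simp only [Matrix.mul_apply]
  exact DifferentiableAt.fun_sum fun k _ => (hM i k).mul (hN k j)

theorem pdMat_mul (hM : DiffEntries M q) (hN : DiffEntries N q) (h : Fin n) :
    pdMat (fun x => M x * N x) h q = pdMat M h q * N q + M q * pdMat N h q := by
  ext i j
  simp only [pdMat, pd, Matrix.of_apply, Matrix.mul_apply, Matrix.add_apply]
  rw [fderiv_fun_sum fun k _ => (hM i k).fun_mul (hN k j), ← Finset.sum_add_distrib]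
  simp only [_root_.sum_apply]
  refine Finset.sum_congr rfl fun k _ => ?_
  rw [fderiv_fun_mul (hM i k) (hN k j)]
  simp
  ring

theorem DiffEntries.linearCombination {ι : Type*} (s : Finset ι) (a : ι → ℝ)
    {M : ι → (Fin n → ℝ) → Matrix (Fin n) (Fin n) ℝ} (hM : ∀ k ∈ s, DiffEntries (M k) q) :
    DiffEntries (fun x => ∑ k ∈ s, a k • M k x) q := by
  intro i j
  simp only [Matrix.sum_apply, Matrix.smul_apply]
  exact DifferentiableAt.fun_sum fun k hk => (hM k hk i j).fun_const_smul (a k)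

theorem pdMat_linearCombination {ι : Type*} (s : Finset ι) (a : ι → ℝ)
    {M : ι → (Fin n → ℝ) → Matrix (Fin n) (Fin n) ℝ} (hM : ∀ k ∈ s, DiffEntries (M k) q)
    (h : Fin n) :
    pdMat (fun x => ∑ k ∈ s, a k • M k x) h q = ∑ k ∈ s, a k • pdMat (M k) h q := by
  ext i j
  simp only [pdMat, pd, Matrix.of_apply, Matrix.sum_apply, Matrix.smul_apply]
  rw [fderiv_fun_sum fun k hk => (hM k hk i j).fun_const_smul (a k)]
  simp only [_root_.sum_apply]
  refine Finset.sum_congr rfl fun k hk => ?_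
  rw [fderiv_fun_const_smul (hM k hk i j)]
  simp

theorem DiffEntries.add_smul (hM : DiffEntries M q) (hN : DiffEntries N q) (ξ : ℝ) :
    DiffEntries (fun x => M x + ξ • N x) q := fun i j =>
  (hM i j).add ((hN i j).fun_const_smul ξ)

theorem pdMat_add_smul (hM : DiffEntries M q) (hN : DiffEntries N q) (ξ : ℝ) (h : Fin n) :
    pdMat (fun x => M x + ξ • N x) h q = pdMat M h q + ξ • pdMat N h q := by
  ext i j
  simp only [pdMat, pd, Matrix.of_apply, Matrix.add_apply, Matrix.smul_apply]
  rw [fderiv_fun_add (hM i j) ((hN i j).fun_const_smul ξ), fderiv_fun_const_smul (hN i j)]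
  simp

/-- The determinant as a continuous multilinear map in the rows. -/
def detCMM (n : ℕ) : ContinuousMultilinearMap ℝ (fun _ : Fin n => Fin n → ℝ) ℝ :=
  ⟨(Matrix.detRowAlternating (R := ℝ) (n := Fin n)).toMultilinearMap, by
    change Continuous fun A : Matrix (Fin n) (Fin n) ℝ => A.det
    exact continuous_id.matrix_det⟩

theorem hasFDerivAt_rows (hM : DiffEntries M q) :
    HasFDerivAt (fun x => (fun i j => M x i j : Fin n → Fin n → ℝ))
      (ContinuousLinearMap.pi fun i => ContinuousLinearMap.pi fun j =>
        fderiv ℝ (fun x => M x i j) q) q := by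
  rw [hasFDerivAt_pi']
  intro i
  rw [hasFDerivAt_pi']
  intro j
  exact (hM i j).hasFDerivAt

theorem DiffEntries.det (hM : DiffEntries M q) : DifferentiableAt ℝ (fun x => (M x).det) q :=
  (((detCMM n).hasFDerivAt (fun i j => M q i j)).comp q (hasFDerivAt_rows hM)).differentiableAt

/-- Jacobi's formula. -/
theorem pd_det (hM : DiffEntries M q) (h : Fin n) :
    pd (fun x => (M x).det) h q = ((M q).adjugate * pdMat M h q).trace := by
  have H := ((detCMM n).hasFDerivAt (fun i j => M q i j)).comp q (hasFDerivAt_rows hM)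
  have H' : fderiv ℝ (fun x => (M x).det) q = _ := H.fderiv
  rw [pd, H', Matrix.trace_mul_comm]
  simp only [ContinuousLinearMap.comp_apply, ContinuousMultilinearMap.linearDeriv_apply,
    Matrix.trace, Matrix.diag]
  refine Finset.sum_congr rfl fun i _ => ?_
  change ((M q).updateRow i (pdMat M h q i)).det = _
  rw [← Matrix.cramer_transpose_apply, Matrix.cramer_eq_adjugate_mulVec,
    ← Matrix.adjugate_transpose, Matrix.mulVec_transpose]
  rfl

theorem DiffEntries.adjugate (hM : DiffEntries M q) : DiffEntries (fun x => (M x).adjugate) q := by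
  intro i j
  simp only [Matrix.adjugate_apply]
  refine DiffEntries.det fun k l => ?_
  by_cases hk : k = j
  · subst hk
    simp
  · simpa [Matrix.updateRow_ne hk] using hM k l

theorem DiffEntries.inv (hM : DiffEntries M q) (hdet : (M q).det ≠ 0) :
    DiffEntries (fun x => (M x)⁻¹) q := by
  intro i j
  simp only [Matrix.inv_def, Matrix.smul_apply, Ring.inverse_eq_inv', smul_eq_mul]
  exact (hM.det.inv hdet).mul (hM.adjugate i j)

theorem pdMat_inv (hM : DiffEntries M q) (hdet : (M q).det ≠ 0) (h : Fin n) :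
    pdMat (fun x => (M x)⁻¹) h q = -((M q)⁻¹ * pdMat M h q * (M q)⁻¹) := by
  have hev : (fun x => M x * (M x)⁻¹) =ᶠ[nhds q] fun _ => 1 :=
    (hM.det.continuousAt.eventually_ne hdet).mono fun x hx =>
      Matrix.mul_nonsing_inv _ (isUnit_iff_ne_zero.mpr hx)
  have h1 := pdMat_congr hev h
  rw [pdMat_mul hM (hM.inv hdet), pdMat_const] at h1
  have h2 := congrArg (fun A => (M q)⁻¹ * A) h1
  simp only [mul_add, mul_zero, ← mul_assoc,
    Matrix.nonsing_inv_mul _ (isUnit_iff_ne_zero.mpr hdet), one_mul] at h2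
  exact eq_neg_of_add_eq_zero_right h2

/-- `∂(adj M) · M = ∂(det M) - adj M · ∂M`. -/
theorem pdMat_adjugate_mul (hM : DiffEntries M q) (h : Fin n) :
    pdMat (fun x => (M x).adjugate) h q * M q =
      ((M q).adjugate * pdMat M h q).trace • (1 : Matrix (Fin n) (Fin n) ℝ) -
        (M q).adjugate * pdMat M h q := by
  rw [← pd_det hM, eq_sub_iff_add_eq, ← pdMat_mul hM.adjugate hM]
  simp only [Matrix.adjugate_mul]
  ext i j
  simp only [pdMat, Matrix.smul_apply, Matrix.of_apply, pd, smul_eq_mul]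
  rw [fderiv_mul_const hM.det]
  simp [mul_comm]

/-- Chain rule along a curve, in terms of partial derivatives. -/
theorem hasDerivAt_comp_pd {f : (Fin n → ℝ) → ℝ} {c : ℝ → Fin n → ℝ} {v : Fin n → ℝ} {t : ℝ}
    (hf : DifferentiableAt ℝ f (c t)) (hc : HasDerivAt c v t) :
    HasDerivAt (fun s => f (c s)) (∑ h, v h * pd f h (c t)) t := by
  refine (hf.hasFDerivAt.comp_hasDerivAt t hc).congr_deriv ?_
  conv_lhs => rw [← Finset.univ_sum_single v, map_sum]
  refine Finset.sum_congr rfl fun h _ => ?_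
  rw [pd, ← smul_eq_mul, ← map_smul, ← Pi.single_smul, smul_eq_mul, mul_one]

/-- Derivative of a time-dependent quadratic form along a curve. -/
theorem hasDerivAt_quadraticForm {P : ℝ → Fin n → ℝ} {N : ℝ → Matrix (Fin n) (Fin n) ℝ}
    {P' : Fin n → ℝ} {N' : Matrix (Fin n) (Fin n) ℝ} {t : ℝ}
    (hP : HasDerivAt P P' t) (hN : ∀ i j, HasDerivAt (fun s => N s i j) (N' i j) t)
    (hsymm : (N t).IsSymm) :
    HasDerivAt (fun s => (1 / 2) * (P s ⬝ᵥ (N s *ᵥ P s)))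
      ((1 / 2) * (P t ⬝ᵥ (N' *ᵥ P t)) + P' ⬝ᵥ (N t *ᵥ P t)) t := by
  have hP' := hasDerivAt_pi.mp hP
  have key : HasDerivAt (fun s => P s ⬝ᵥ (N s *ᵥ P s))
      (P' ⬝ᵥ (N t *ᵥ P t) + P t ⬝ᵥ (N' *ᵥ P t + N t *ᵥ P')) t := by
    simp only [dotProduct, Matrix.mulVec, Pi.add_apply, ← Finset.sum_add_distrib]
    exact HasDerivAt.fun_sum fun i _ => (hP' i).mul
      (HasDerivAt.fun_sum fun j _ => (hN i j).mul (hP' j))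
  refine (key.const_mul (1 / 2)).congr_deriv ?_
  have hs : P t ⬝ᵥ (N t *ᵥ P') = P' ⬝ᵥ (N t *ᵥ P t) := by
    rw [Matrix.dotProduct_mulVec, ← Matrix.mulVec_transpose, hsymm.eq, dotProduct_comm]
  rw [dotProduct_add, hs]
  ring

end MatrixFields

/-- The matrix `(Γ_h)^i_j = Γ^i_{hj}` of Christoffel symbols. -/
def christoffelMat {n : ℕ} (g : (Fin n → ℝ) → Matrix (Fin n) (Fin n) ℝ) (h : Fin n)
    (q : Fin n → ℝ) : Matrix (Fin n) (Fin n) ℝ :=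
  Matrix.of fun i j => christoffel g i h j q

section Metric

variable {n : ℕ} {g : (Fin n → ℝ) → Matrix (Fin n) (Fin n) ℝ} {q : Fin n → ℝ}

theorem christoffel_symm (hsymm : ∀ᶠ x in nhds q, (g x).IsSymm) (i j k : Fin n) :
    christoffel g i j k q = christoffel g i k j q := by
  have hs : ∀ l, pd (fun x => g x j k) l q = pd (fun x => g x k j) l q := fun l =>
    pd_congr (hsymm.mono fun x hx => hx.apply k j) l
  simp only [christoffel, hs]
  congr 1
  refine Finset.sum_congr rfl fun l _ => ?_
  ring

theorem sum_dotProduct_christoffelMat_mulVec_comm (hsymm : ∀ᶠ x in nhds q, (g x).IsSymm)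
    (p x w : Fin n → ℝ) :
    ∑ m, x m * (p ⬝ᵥ (christoffelMat g m q *ᵥ w)) =
      ∑ j, w j * (p ⬝ᵥ (christoffelMat g j q *ᵥ x)) := by
  have hvec : ∑ m, x m • (christoffelMat g m q *ᵥ w) =
      ∑ j, w j • (christoffelMat g j q *ᵥ x) := by
    ext k
    simp only [Finset.sum_apply, Pi.smul_apply, christoffelMat, Matrix.of_apply, Matrix.mulVec,
      dotProduct, smul_eq_mul, Finset.mul_sum]
    rw [Finset.sum_comm]
    refine Finset.sum_congr rfl fun j _ => Finset.sum_congr rfl fun m _ => ?_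
    rw [christoffel_symm hsymm]
    ring
  have := congrArg (fun y => p ⬝ᵥ y) hvec
  simpa only [dotProduct_sum, dotProduct_smul, smul_eq_mul] using this

/-- The Levi-Civita connection is metric: `∂_h G = -(Γ_h G + G Γ_hᵀ)`. -/
theorem pdMat_inv_metric (hg : DiffEntries g q) (hsymm : ∀ᶠ x in nhds q, (g x).IsSymm)
    (hdet : (g q).det ≠ 0) (h : Fin n) :
    pdMat (fun x => (g x)⁻¹) h q =
      -(christoffelMat g h q * (g q)⁻¹ + (g q)⁻¹ * (christoffelMat g h q)ᵀ) := by
  have hs : ∀ i j l, pd (fun x => g x i j) l q = pd (fun x => g x j i) l q := fun i j l =>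
    pd_congr (hsymm.mono fun x hx => hx.apply j i) l
  have hG : ((g q)⁻¹)ᵀ = (g q)⁻¹ := by
    rw [Matrix.transpose_nonsing_inv, hsymm.self_of_nhds.eq]
  set X : Matrix (Fin n) (Fin n) ℝ :=
    Matrix.of fun l k => pd (fun x => g x l h) k q - pd (fun x => g x h k) l q with hX
  have hXt : Xᵀ = -X := by
    ext i j
    simp only [hX, Matrix.transpose_apply, Matrix.of_apply, Matrix.neg_apply]
    rw [hs j h, hs h i]
    ring
  have hDt : (pdMat g h q)ᵀ = pdMat g h q := by
    ext i j
    exact hs j i h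
  have hΓ : christoffelMat g h q = (1 / 2 : ℝ) • ((g q)⁻¹ * (pdMat g h q + X)) := by
    ext i j
    simp only [christoffelMat, christoffel, hX, pdMat, Matrix.of_apply, Matrix.smul_apply,
      Matrix.mul_apply, Matrix.add_apply, smul_eq_mul]
    congr 1
    refine Finset.sum_congr rfl fun l _ => ?_
    ring
  rw [pdMat_inv hg hdet, hΓ, Matrix.transpose_smul, Matrix.transpose_mul, Matrix.transpose_add,
    hG, hXt, hDt]
  simp only [Matrix.mul_add, Matrix.add_mul, Matrix.smul_mul, Matrix.mul_smul, Matrix.neg_mul,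
    Matrix.mul_neg, ← Matrix.mul_assoc]
  module

end Metric

/-- Pointwise form of the J-tensor equation:
`∂_h J = J Γ_h - Γ_h J + e_h αᵀ + (Gα) (g e_h)ᵀ`. -/
def JTensorAt {n : ℕ} (g J : (Fin n → ℝ) → Matrix (Fin n) (Fin n) ℝ) (α : Fin n → ℝ)
    (q : Fin n → ℝ) : Prop :=
  ∀ h, pdMat J h q = J q * christoffelMat g h q - christoffelMat g h q * J q +
    (vecMulVec (Pi.single h 1) α + vecMulVec ((g q)⁻¹ *ᵥ α) (g q *ᵥ Pi.single h 1))

theorem IsJTensor.exists_jTensorAt {n : ℕ} {U : Set (Fin n → ℝ)}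
    {g J : (Fin n → ℝ) → Matrix (Fin n) (Fin n) ℝ} (hJ : IsJTensor U g J) {q : Fin n → ℝ}
    (hq : q ∈ U) : ∃ α, JTensorAt g J α q := by
  obtain ⟨-, -, α, hα⟩ := hJ
  refine ⟨α q, fun h => ?_⟩
  ext i j
  have e := hα q hq h i j
  simp only [covDeriv] at e
  simp only [pdMat, Matrix.of_apply, Matrix.add_apply, Matrix.sub_apply, vecMulVec_apply,
    Matrix.mulVec_single_one, Matrix.col_apply, Matrix.mul_apply, christoffelMat,
    Matrix.mulVec, dotProduct, Pi.single_apply]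
  have e2 : ∑ k, J q i k * christoffel g k h j q = ∑ k, christoffel g k h j q * J q i k :=
    Finset.sum_congr rfl fun _ _ => mul_comm _ _
  rw [e2]
  linarith

theorem JTensorAt.add_smul {n : ℕ} {g J J' : (Fin n → ℝ) → Matrix (Fin n) (Fin n) ℝ}
    {α α' : Fin n → ℝ} {q : Fin n → ℝ} (h : JTensorAt g J α q) (h' : JTensorAt g J' α' q)
    (hd : DiffEntries J q) (hd' : DiffEntries J' q) (ξ : ℝ) :
    JTensorAt g (fun x => J x + ξ • J' x) (α + ξ • α') q := by
  intro k
  rw [pdMat_add_smul hd hd', h k, h' k]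
  simp only [Matrix.add_mul, Matrix.mul_add, Matrix.smul_mul, Matrix.mul_smul, Matrix.mulVec_add,
    Matrix.mulVec_smul, vecMulVec_add, add_vecMulVec, vecMulVec_smul, smul_vecMulVec]
  module

/-- If `JG` is symmetric and `J` is nonsingular, then `cof(J) G` is symmetric. -/
theorem adjugate_mul_eq_mul_transpose {n : ℕ} {J G : Matrix (Fin n) (Fin n) ℝ}
    (hJG : J * G = G * Jᵀ) (hJ : J.det ≠ 0) : J.adjugate * G = G * J.adjugateᵀ := by
  have h := congrArg (fun M => J.adjugate * M * J.adjugateᵀ) hJG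
  rw [← Matrix.mul_assoc, Matrix.adjugate_mul, Matrix.mul_assoc J.adjugate (G * Jᵀ),
    Matrix.mul_assoc G, ← Matrix.transpose_mul, Matrix.adjugate_mul] at h
  simp only [Matrix.smul_mul, Matrix.one_mul, Matrix.transpose_smul, Matrix.transpose_one,
    Matrix.mul_smul, Matrix.mul_one] at h
  exact (smul_right_injective _ hJ h).symm

theorem inv_mulVec_dotProduct_mulVec {n : ℕ} {S : Matrix (Fin n) (Fin n) ℝ} (hS : S.IsSymm)
    (hdet : S.det ≠ 0) (u w : Fin n → ℝ) : (S⁻¹ *ᵥ u) ⬝ᵥ (S *ᵥ w) = u ⬝ᵥ w := by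
  rw [Matrix.dotProduct_mulVec, ← Matrix.mulVec_transpose, hS.eq, Matrix.mulVec_mulVec,
    Matrix.mul_nonsing_inv _ (isUnit_iff_ne_zero.mpr hdet), Matrix.one_mulVec]

section Adjugate

variable {n : ℕ} {g J : (Fin n → ℝ) → Matrix (Fin n) (Fin n) ℝ} {q α : Fin n → ℝ}

/-- Derivative of the cofactor matrix of a J-tensor. -/
theorem JTensorAt.det_smul_pdMat_adjugate (hJ : JTensorAt g J α q) (hJd : DiffEntries J q)
    (hgs : (g q).IsSymm) (hgdet : (g q).det ≠ 0)
    (hA : (J q).adjugate * (g q)⁻¹ = (g q)⁻¹ * (J q).adjugateᵀ) (h : Fin n) :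
    (J q).det • pdMat (fun x => (J x).adjugate) h q =
      (J q).det • ((J q).adjugate * christoffelMat g h q -
        christoffelMat g h q * (J q).adjugate) +
      ((2 * (α ⬝ᵥ ((J q).adjugate *ᵥ Pi.single h 1))) • (J q).adjugate -
        (J q).adjugate * (vecMulVec (Pi.single h 1) α +
          vecMulVec ((g q)⁻¹ *ᵥ α) (g q *ᵥ Pi.single h 1)) * (J q).adjugate) := by
  have e1 := pdMat_adjugate_mul hJd h
  have e2 := congrArg (fun M => M * (J q).adjugate) e1
  rw [hJ h, Matrix.mul_assoc, Matrix.mul_adjugate] at e2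
  set A := (J q).adjugate
  set Γ := christoffelMat g h q
  set R := vecMulVec (Pi.single h 1) α + vecMulVec ((g q)⁻¹ *ᵥ α) (g q *ᵥ Pi.single h 1) with hR
  have hAJ : A * J q = (J q).det • 1 := Matrix.adjugate_mul _
  have hJA : J q * A = (J q).det • 1 := Matrix.mul_adjugate _
  have hAD : A * (J q * Γ - Γ * J q + R) = (J q).det • Γ - A * Γ * J q + A * R := by
    rw [Matrix.mul_add, Matrix.mul_sub, ← Matrix.mul_assoc, hAJ, ← Matrix.mul_assoc]
    simp
  have htrR : (A * R).trace = 2 * (α ⬝ᵥ (A *ᵥ Pi.single h 1)) := by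
    rw [hR, Matrix.mul_add, Matrix.trace_add, Matrix.mul_vecMulVec, Matrix.mul_vecMulVec,
      Matrix.trace_vecMulVec, Matrix.trace_vecMulVec, Matrix.mulVec_mulVec, hA,
      ← Matrix.mulVec_mulVec, inv_mulVec_dotProduct_mulVec hgs hgdet, Matrix.mulVec_transpose,
      ← Matrix.dotProduct_mulVec, dotProduct_comm _ α]
    ring
  have htr : (A * (J q * Γ - Γ * J q + R)).trace = 2 * (α ⬝ᵥ (A *ᵥ Pi.single h 1)) := by
    rw [hAD, Matrix.trace_add, Matrix.trace_sub, htrR, Matrix.mul_assoc, Matrix.trace_mul_comm A,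
      Matrix.mul_assoc, hJA]
    simp
  rw [htr, hAD] at e2
  simp only [Matrix.mul_smul, Matrix.mul_one, Matrix.sub_mul, Matrix.add_mul, Matrix.smul_mul,
    Matrix.one_mul] at e2
  rw [e2, Matrix.mul_assoc (A * Γ), hJA]
  simp only [Matrix.mul_smul, Matrix.mul_one]
  module

/-- Derivative of the quadratic form `pᵀ cof(J) G p`. -/
theorem JTensorAt.quadraticForm (hJ : JTensorAt g J α q) (hJd : DiffEntries J q)
    (hg : DiffEntries g q) (hsymm : ∀ᶠ x in nhds q, (g x).IsSymm) (hgdet : (g q).det ≠ 0)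
    (hA : (J q).adjugate * (g q)⁻¹ = (g q)⁻¹ * (J q).adjugateᵀ) (p : Fin n → ℝ) (h : Fin n) :
    (J q).det * (p ⬝ᵥ (pdMat (fun x => (J x).adjugate * (g x)⁻¹) h q *ᵥ p)) =
      -2 * (J q).det * (p ⬝ᵥ (christoffelMat g h q *ᵥ ((J q).adjugate *ᵥ ((g q)⁻¹ *ᵥ p)))) +
      2 * ((α ⬝ᵥ ((J q).adjugate *ᵥ Pi.single h 1)) *
          (p ⬝ᵥ ((J q).adjugate *ᵥ ((g q)⁻¹ *ᵥ p))) -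
        (p ⬝ᵥ ((J q).adjugate *ᵥ Pi.single h 1)) *
          (α ⬝ᵥ ((J q).adjugate *ᵥ ((g q)⁻¹ *ᵥ p)))) := by
  have hgs := hsymm.self_of_nhds
  have e := hJ.det_smul_pdMat_adjugate hJd hgs hgdet hA h
  rw [pdMat_mul hJd.adjugate (hg.inv hgdet), pdMat_inv_metric hg hsymm hgdet]
  set A := (J q).adjugate with hAdef
  set Γ := christoffelMat g h q
  set G := (g q)⁻¹ with hGdef
  set D := pdMat (fun x => (J x).adjugate) h q
  set v := G *ᵥ p with hv
  have hGs : Gᵀ = G := by rw [hGdef, Matrix.transpose_nonsing_inv, hgs.eq]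
  have hcross : p ⬝ᵥ (A *ᵥ (G *ᵥ (Γᵀ *ᵥ p))) = p ⬝ᵥ (Γ *ᵥ (A *ᵥ v)) := by
    rw [hv, Matrix.mulVec_mulVec p A G, hA, ← Matrix.mulVec_mulVec p G, Matrix.mulVec_transpose Γ,
      Matrix.mulVec_transpose A, Matrix.dotProduct_mulVec p A, Matrix.dotProduct_mulVec _ G,
      ← Matrix.mulVec_transpose G, hGs, Matrix.dotProduct_mulVec p Γ, dotProduct_comm]
  have hgAv : (A *ᵥ v) ⬝ᵥ (g q *ᵥ Pi.single h 1) = p ⬝ᵥ (A *ᵥ Pi.single h 1) := by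
    rw [hv, Matrix.mulVec_mulVec, hA, ← Matrix.mulVec_mulVec, hGdef,
      inv_mulVec_dotProduct_mulVec hgs hgdet, Matrix.mulVec_transpose, ← Matrix.dotProduct_mulVec]
  have hGα : p ⬝ᵥ (A *ᵥ (G *ᵥ α)) = α ⬝ᵥ (A *ᵥ v) := by
    rw [Matrix.mulVec_mulVec, hA, ← Matrix.mulVec_mulVec, Matrix.dotProduct_mulVec p G,
      ← Matrix.mulVec_transpose, hGs, ← hv, Matrix.mulVec_transpose, dotProduct_comm,
      ← Matrix.dotProduct_mulVec]
  have e2 := congrArg (fun M => p ⬝ᵥ (M *ᵥ v)) e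
  simp only [Matrix.add_mulVec, Matrix.sub_mulVec, Matrix.smul_mulVec, Matrix.mul_add,
    Matrix.add_mul, ← Matrix.mulVec_mulVec, dotProduct_add, dotProduct_sub, dotProduct_smul,
    Matrix.vecMulVec_mulVec, smul_eq_mul, Matrix.mulVec_smul,
    op_smul_eq_smul] at e2
  rw [hGα, dotProduct_comm (g q *ᵥ _), hgAv] at e2
  simp only [Matrix.add_mulVec, Matrix.neg_mulVec, Matrix.mul_add, Matrix.mul_neg,
    ← Matrix.mulVec_mulVec, dotProduct_add, dotProduct_neg]
  rw [hcross, mul_add, ← hv, e2]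
  ring

/-- The Killing property: `v^h pᵀ (∂_h (cof(J) G)) p = -2 pᵀ Γ_v cof(J) G p` for `v = G p`. -/
theorem JTensorAt.killing (hJ : JTensorAt g J α q) (hJd : DiffEntries J q)
    (hg : DiffEntries g q) (hsymm : ∀ᶠ x in nhds q, (g x).IsSymm) (hgdet : (g q).det ≠ 0)
    (hJdet : (J q).det ≠ 0)
    (hA : (J q).adjugate * (g q)⁻¹ = (g q)⁻¹ * (J q).adjugateᵀ) (p : Fin n → ℝ) :
    ∑ h, ((g q)⁻¹ *ᵥ p) h * (p ⬝ᵥ (pdMat (fun x => (J x).adjugate * (g x)⁻¹) h q *ᵥ p)) =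
      -2 * ∑ h, ((g q)⁻¹ *ᵥ p) h *
        (p ⬝ᵥ (christoffelMat g h q *ᵥ (((J q).adjugate * (g q)⁻¹) *ᵥ p))) := by
  have hsum : ∀ u : Fin n → ℝ, ∑ h, ((g q)⁻¹ *ᵥ p) h *
      (u ⬝ᵥ ((J q).adjugate *ᵥ Pi.single h 1)) =
        u ⬝ᵥ ((J q).adjugate *ᵥ ((g q)⁻¹ *ᵥ p)) := by
    intro u
    rw [Matrix.dotProduct_mulVec u, dotProduct_comm]
    simp only [Matrix.dotProduct_mulVec u, dotProduct_single_one]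
    rfl
  apply mul_left_cancel₀ hJdet
  rw [Finset.mul_sum]
  simp only [mul_left_comm (J q).det, hJ.quadraticForm hJd hg hsymm hgdet hA, Finset.mul_sum,
    ← Matrix.mulVec_mulVec]
  rw [← sub_eq_zero, ← Finset.sum_sub_distrib]
  have h1 := hsum α
  have h2 := hsum p
  set v := (g q)⁻¹ *ᵥ p
  set A := (J q).adjugate
  calc _ = 2 * ((p ⬝ᵥ (A *ᵥ v)) * ∑ h, v h * (α ⬝ᵥ (A *ᵥ Pi.single h 1)) -
          (α ⬝ᵥ (A *ᵥ v)) * ∑ h, v h * (p ⬝ᵥ (A *ᵥ Pi.single h 1))) := by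
        rw [Finset.mul_sum, Finset.mul_sum, ← Finset.sum_sub_distrib, Finset.mul_sum]
        refine Finset.sum_congr rfl fun h _ => ?_
        ring
    _ = 0 := by
        rw [h1, h2]
        ring

/-- The momentum equation of the quasi-Hamiltonian system without potential is the geodesic
equation. -/
theorem JTensorAt.momentum (hJ : JTensorAt g J α q) (hJd : DiffEntries J q)
    (hg : DiffEntries g q) (hsymm : ∀ᶠ x in nhds q, (g x).IsSymm) (hgdet : (g q).det ≠ 0)
    (hJdet : (J q).det ≠ 0)
    (hA : (J q).adjugate * (g q)⁻¹ = (g q)⁻¹ * (J q).adjugateᵀ) (p : Fin n → ℝ) (i : Fin n) :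
    -(∑ m, J q m i * ((1 / 2) * (p ⬝ᵥ (pdMat (fun x => (J x).adjugate * (g x)⁻¹) m q *ᵥ p)))) +
      ∑ j, Omega J q p i j * (((J q).adjugate * (g q)⁻¹) *ᵥ p) j =
    (J q).det * (p ⬝ᵥ (christoffelMat g i q *ᵥ ((g q)⁻¹ *ᵥ p))) := by
  set w := ((J q).adjugate * (g q)⁻¹) *ᵥ p with hw
  have hJw : J q *ᵥ w = (J q).det • ((g q)⁻¹ *ᵥ p) := by
    rw [hw, Matrix.mulVec_mulVec, ← Matrix.mul_assoc, Matrix.mul_adjugate, Matrix.smul_mul,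
      Matrix.one_mul, Matrix.smul_mulVec]
  have hsum : ∀ u : Fin n → ℝ,
      ∑ m, J q m i * (u ⬝ᵥ ((J q).adjugate *ᵥ Pi.single m 1)) = (J q).det * u i := by
    intro u
    have e : u ᵥ* (J q).adjugate ᵥ* J q = (J q).det • u := by
      rw [Matrix.vecMul_vecMul, Matrix.adjugate_mul, Matrix.vecMul_smul, Matrix.vecMul_one]
    have e' := congrFun e i
    simp only [Pi.smul_apply, smul_eq_mul] at e'
    rw [← e']
    simp only [Matrix.dotProduct_mulVec u, dotProduct_single_one]
    exact Finset.sum_congr rfl fun m _ => mul_comm _ _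
  have hkin : ∑ m, J q m i *
      ((1 / 2) * (p ⬝ᵥ (pdMat (fun x => (J x).adjugate * (g x)⁻¹) m q *ᵥ p))) =
      -(∑ m, J q m i * (p ⬝ᵥ (christoffelMat g m q *ᵥ w))) +
        α i * (p ⬝ᵥ w) - p i * (α ⬝ᵥ w) := by
    apply mul_left_cancel₀ hJdet
    calc _ = ∑ m, (1 / 2) * J q m i * ((J q).det *
          (p ⬝ᵥ (pdMat (fun x => (J x).adjugate * (g x)⁻¹) m q *ᵥ p))) := by
          rw [Finset.mul_sum]
          refine Finset.sum_congr rfl fun m _ => ?_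
          ring
      _ = -((J q).det * ∑ m, J q m i * (p ⬝ᵥ (christoffelMat g m q *ᵥ w))) +
          (p ⬝ᵥ w) * ∑ m, J q m i * (α ⬝ᵥ ((J q).adjugate *ᵥ Pi.single m 1)) -
          (α ⬝ᵥ w) * ∑ m, J q m i * (p ⬝ᵥ ((J q).adjugate *ᵥ Pi.single m 1)) := by
          simp only [hJ.quadraticForm hJd hg hsymm hgdet hA, Matrix.mulVec_mulVec p, ← hw]
          simp only [Finset.mul_sum]
          rw [← Finset.sum_neg_distrib, ← Finset.sum_add_distrib, ← Finset.sum_sub_distrib]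
          refine Finset.sum_congr rfl fun m _ => ?_
          ring
      _ = _ := by
          rw [hsum, hsum]
          ring
  have hΩ : ∑ j, Omega J q p i j * w j =
      ∑ j, w j * (p ⬝ᵥ (pdMat J j q *ᵥ Pi.single i 1)) - p ⬝ᵥ (pdMat J i q *ᵥ w) := by
    have e : p ⬝ᵥ (pdMat J i q *ᵥ w) = ∑ j, w j * ∑ k, p k * pdMat J i q k j := by
      rw [Matrix.dotProduct_mulVec, dotProduct_comm]
      rfl
    rw [e, ← Finset.sum_sub_distrib]
    refine Finset.sum_congr rfl fun j _ => ?_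
    rw [← mul_sub, mul_comm]
    simp only [Omega, Matrix.mulVec_single_one, dotProduct, Matrix.col_apply, pdMat,
      Matrix.of_apply]
    rw [← Finset.sum_sub_distrib]
    congr 1
    refine Finset.sum_congr rfl fun k _ => ?_
    ring
  have hΓ1 : ∑ j, w j * (p ⬝ᵥ (J q *ᵥ (christoffelMat g j q *ᵥ Pi.single i 1))) =
      p ⬝ᵥ (J q *ᵥ (christoffelMat g i q *ᵥ w)) := by
    simp only [Matrix.dotProduct_mulVec p (J q)]
    rw [← sum_dotProduct_christoffelMat_mulVec_comm hsymm]
    simp [Pi.single_apply]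
  have hΓ2 : ∑ m, J q m i * (p ⬝ᵥ (christoffelMat g m q *ᵥ w)) =
      ∑ j, w j * (p ⬝ᵥ (christoffelMat g j q *ᵥ (J q *ᵥ Pi.single i 1))) := by
    rw [← sum_dotProduct_christoffelMat_mulVec_comm hsymm, Matrix.mulVec_single_one]
    rfl
  have hgw : ∑ j, w j * (g q j i) = (g q *ᵥ Pi.single i 1) ⬝ᵥ w := by
    simp [dotProduct, mul_comm]
  have hpw : ∑ j, w j * p j = p ⬝ᵥ w := dotProduct_comm _ _
  have hgs : ∀ j, g q i j = g q j i := fun j => hsymm.self_of_nhds.apply j i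
  rw [hkin, hΩ]
  simp only [hJ _, Matrix.add_mulVec, Matrix.sub_mulVec, ← Matrix.mulVec_mulVec,
    Matrix.vecMulVec_mulVec, dotProduct_add, dotProduct_sub, op_smul_eq_smul, dotProduct_smul,
    dotProduct_single_one, smul_eq_mul, mul_add, mul_sub, Finset.sum_add_distrib,
    Finset.sum_sub_distrib, hJw, Matrix.mulVec_smul]
  rw [hΓ1, hΓ2, ← hgw]
  simp only [Matrix.mulVec_single_one, Matrix.col_apply, hgs, mul_left_comm (w _) (α i),
    ← mul_assoc (w _), ← Finset.mul_sum, ← Finset.sum_mul, hpw]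
  ring

end Adjugate

section PartialDerivatives

variable {n : ℕ}

theorem pd_eq_of_hasDerivAt_line {f : (Fin n → ℝ) → ℝ} {q : Fin n → ℝ} {j : Fin n} {f' : ℝ}
    (hf : DifferentiableAt ℝ f q)
    (h : HasDerivAt (fun s : ℝ => f (q + s • Pi.single j 1)) f' 0) : pd f j q = f' := by
  have hline : HasDerivAt (fun s : ℝ => q + s • (Pi.single j 1 : Fin n → ℝ))
      (Pi.single j 1) 0 := by
    simpa using ((hasDerivAt_id (0 : ℝ)).smul_const (Pi.single j 1 : Fin n → ℝ)).const_add q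
  have hf0 : DifferentiableAt ℝ f (q + (0 : ℝ) • (Pi.single j 1 : Fin n → ℝ)) := by simpa using hf
  have := (hasDerivAt_comp_pd hf0 hline).unique h
  simpa [Pi.single_apply] using this

theorem pd_quadraticForm_momentum {M : Matrix (Fin n) (Fin n) ℝ} (hM : M.IsSymm) (C : ℝ)
    (j : Fin n) (p : Fin n → ℝ) :
    pd (fun p' => (1 / 2) * (p' ⬝ᵥ (M *ᵥ p')) + C) j p = (M *ᵥ p) j := by
  have hline : HasDerivAt (fun s : ℝ => p + s • (Pi.single j 1 : Fin n → ℝ))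
      (Pi.single j 1) 0 := by
    simpa using ((hasDerivAt_id (0 : ℝ)).smul_const (Pi.single j 1 : Fin n → ℝ)).const_add p
  refine pd_eq_of_hasDerivAt_line ?_ ?_
  · simp only [dotProduct, Matrix.mulVec]
    fun_prop
  · refine ((hasDerivAt_quadraticForm (N := fun _ => M) (N' := 0) hline
      (fun _ _ => hasDerivAt_const _ _) hM).add_const C).congr_deriv ?_
    simp

theorem pd_quadraticForm_position {N : (Fin n → ℝ) → Matrix (Fin n) (Fin n) ℝ}
    {V : (Fin n → ℝ) → ℝ} {q : Fin n → ℝ} (hN : DiffEntries N q) (hV : DifferentiableAt ℝ V q)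
    (p : Fin n → ℝ) (j : Fin n) :
    pd (fun q' => (1 / 2) * (p ⬝ᵥ (N q' *ᵥ p)) + V q') j q =
      (1 / 2) * (p ⬝ᵥ (pdMat N j q *ᵥ p)) + pd V j q := by
  have hq : ∀ i, HasFDerivAt (fun x => (N x *ᵥ p) i)
      (∑ k, p k • fderiv ℝ (fun x => N x i k) q) q := fun i => by
    simp only [Matrix.mulVec, dotProduct]
    exact HasFDerivAt.fun_sum fun k _ => (hN i k).hasFDerivAt.mul_const (p k)
  have h1 : HasFDerivAt (fun x => p ⬝ᵥ (N x *ᵥ p))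
      (∑ i, p i • ∑ k, p k • fderiv ℝ (fun x => N x i k) q) q :=
    HasFDerivAt.fun_sum fun i _ => (hq i).const_mul (p i)
  rw [pd, ((h1.const_mul (1 / 2)).fun_add hV.hasFDerivAt).fderiv]
  simp [pd, pdMat, dotProduct, Matrix.mulVec, mul_comm]

end PartialDerivatives

/-- The coefficients of a matrix polynomial of degree less than `n` are recovered from its values
at `n` distinct points. -/
theorem exists_lagrange_coefficients {n : ℕ} {ξ : Fin n → ℝ} (hξ : Function.Injective ξ) {m : ℕ}
    (hm : m < n) : ∃ a : Fin n → ℝ, ∀ C : ℕ → Matrix (Fin n) (Fin n) ℝ,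
      ∑ k, a k • ∑ i ∈ Finset.range n, ξ k ^ i • C i = C m := by
  have hdet : IsUnit (Matrix.vandermonde ξ).det :=
    isUnit_iff_ne_zero.mpr (Matrix.det_vandermonde_ne_zero_iff.mpr hξ)
  refine ⟨(Matrix.vandermonde ξ)⁻¹ ⟨m, hm⟩, fun C => ?_⟩
  have h (i : Fin n) : ∑ k, (Matrix.vandermonde ξ)⁻¹ ⟨m, hm⟩ k * ξ k ^ (i : ℕ) =
      if (⟨m, hm⟩ : Fin n) = i then 1 else 0 := by
    rw [← Matrix.one_apply, ← Matrix.nonsing_inv_mul _ hdet]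
    rfl
  simp only [Finset.smul_sum, smul_smul]
  rw [Finset.sum_comm, Finset.sum_range]
  simp only [← Finset.sum_smul, h]
  simp

theorem exists_injective_det_add_smul_ne_zero {n : ℕ} (A B : Matrix (Fin n) (Fin n) ℝ)
    (hA : A.det ≠ 0) :
    ∃ ξ : Fin n → ℝ, Function.Injective ξ ∧ ∀ k, (A + ξ k • B).det ≠ 0 := by
  have hcont : Continuous fun x : ℝ => (A + x • B).det :=
    (continuous_const.add (continuous_id.smul continuous_const)).matrix_det
  have hnear : {x : ℝ | (A + x • B).det ≠ 0} ∈ nhds 0 :=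
    hcont.continuousAt.eventually_ne (by simpa using hA)
  have hinf := infinite_of_mem_nhds 0 hnear
  refine ⟨fun k => hinf.natEmbedding _ k, fun a b hab => ?_, fun k => (hinf.natEmbedding _ k).2⟩
  exact Fin.ext ((hinf.natEmbedding _).injective (Subtype.ext hab))

/-- If `cof(J₂ + ξJ₁) = Σ ξ^i K_{n-i}` with `J₁`, `J₂` J-tensors and `J₂` nonsingular, then `K_r G`
is differentiable and symmetric and has the Killing property. -/
theorem cofactor_coefficient_killing {n : ℕ} {U : Set (Fin n → ℝ)} (hU : IsOpen U)
    {g J₁ J₂ : (Fin n → ℝ) → Matrix (Fin n) (Fin n) ℝ}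
    (hgsym : ∀ q ∈ U, (g q).IsSymm) (hJ₁ : IsJTensor U g J₁) (hJ₂ : IsJTensor U g J₂)
    {K : ℕ → (Fin n → ℝ) → Matrix (Fin n) (Fin n) ℝ}
    (hK : ∀ q ∈ U, ∀ ξ : ℝ,
      (J₂ q + ξ • J₁ q).adjugate = ∑ i ∈ Finset.range n, ξ ^ i • K (n - i) q)
    {q : Fin n → ℝ} (hq : q ∈ U) (hg : DiffEntries g q) (hgdet : (g q).det ≠ 0)
    (hd₁ : DiffEntries J₁ q) (hd₂ : DiffEntries J₂ q) (hJ₂det : (J₂ q).det ≠ 0)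
    {r : ℕ} (hr : r ∈ Finset.Icc 1 n) :
    DiffEntries (fun x => K r x * (g x)⁻¹) q ∧ K r q * (g q)⁻¹ = (g q)⁻¹ * (K r q)ᵀ ∧
      ∀ p : Fin n → ℝ,
        ∑ h, ((g q)⁻¹ *ᵥ p) h * (p ⬝ᵥ (pdMat (fun x => K r x * (g x)⁻¹) h q *ᵥ p)) =
          -2 * ∑ h, ((g q)⁻¹ *ᵥ p) h *
            (p ⬝ᵥ (christoffelMat g h q *ᵥ ((K r q * (g q)⁻¹) *ᵥ p))) := by
  obtain ⟨hr1, hrn⟩ := Finset.mem_Icc.mp hr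
  obtain ⟨ξ, hinj, hdet⟩ := exists_injective_det_add_smul_ne_zero (J₂ q) (J₁ q) hJ₂det
  obtain ⟨a, ha⟩ := exists_lagrange_coefficients hinj (m := n - r) (by omega)
  have hKr : ∀ x ∈ U, K r x = ∑ k, a k • (J₂ x + ξ k • J₁ x).adjugate := by
    intro x hx
    simp only [hK x hx]
    rw [ha (fun i => K (n - i) x)]
    congr 1
    omega
  have hUq : U ∈ nhds q := hU.mem_nhds hq
  have hsymm : ∀ᶠ x in nhds q, (g x).IsSymm := Filter.eventually_of_mem hUq hgsym
  have hGs : ((g q)⁻¹)ᵀ = (g q)⁻¹ := by rw [Matrix.transpose_nonsing_inv, (hgsym q hq).eq]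
  have hJG₁ : J₁ q * (g q)⁻¹ = (g q)⁻¹ * (J₁ q)ᵀ := by
    rw [← (hJ₁.2.1 q hq).eq, Matrix.transpose_mul, hGs]
  have hJG₂ : J₂ q * (g q)⁻¹ = (g q)⁻¹ * (J₂ q)ᵀ := by
    rw [← (hJ₂.2.1 q hq).eq, Matrix.transpose_mul, hGs]
  have hJG : ∀ k, (J₂ q + ξ k • J₁ q).adjugate * (g q)⁻¹ =
      (g q)⁻¹ * (J₂ q + ξ k • J₁ q).adjugateᵀ := fun k =>
    adjugate_mul_eq_mul_transpose (by
      simp only [Matrix.add_mul, Matrix.smul_mul, Matrix.transpose_add, Matrix.transpose_smul,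
        Matrix.mul_add, Matrix.mul_smul, hJG₁, hJG₂]) (hdet k)
  have hd : ∀ k, DiffEntries (fun x => J₂ x + ξ k • J₁ x) q := fun k => hd₂.add_smul hd₁ _
  have hdA : ∀ k ∈ Finset.univ,
      DiffEntries (fun x => (J₂ x + ξ k • J₁ x).adjugate * (g x)⁻¹) q := fun k _ =>
    (hd k).adjugate.mul (hg.inv hgdet)
  have hev : (fun x => K r x * (g x)⁻¹) =ᶠ[nhds q]
      fun x => ∑ k, a k • ((J₂ x + ξ k • J₁ x).adjugate * (g x)⁻¹) :=
    Filter.eventually_of_mem hUq fun x hx => by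
      simp only [hKr x hx, Matrix.sum_mul, Matrix.smul_mul]
  refine ⟨(DiffEntries.linearCombination _ a hdA).congr hev, ?_, fun p => ?_⟩
  · rw [hKr q hq]
    simp only [Matrix.sum_mul, Matrix.smul_mul, Matrix.transpose_sum, Matrix.transpose_smul,
      Matrix.mul_sum, Matrix.mul_smul, hJG]
  · obtain ⟨α₁, hα₁⟩ := hJ₁.exists_jTensorAt hq
    obtain ⟨α₂, hα₂⟩ := hJ₂.exists_jTensorAt hq
    have hkill := fun k => (hα₂.add_smul hα₁ hd₂ hd₁ (ξ k)).killing (hd k) hg hsymm hgdet (hdet k)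
      (hJG k) p
    simp only [pdMat_congr hev, pdMat_linearCombination _ a hdA, hev.self_of_nhds,
      Matrix.sum_mulVec, Matrix.mulVec_sum, Matrix.smul_mulVec, Matrix.mulVec_smul, dotProduct_sum,
      dotProduct_smul, smul_eq_mul]
    simp only [Finset.mul_sum] at hkill ⊢
    rw [Finset.sum_comm]
    conv_rhs => rw [Finset.sum_comm]
    refine Finset.sum_congr rfl fun k _ => ?_
    have := congrArg (fun y => a k * y) (hkill k)
    simp only [Finset.mul_sum] at this
    convert this using 2 <;> ring

/-- The functions `H_r = (1/2)pᵀK_rGp + V_r`, with `K_r` from the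
expansion `cof(J₂ + ξJ₁) = Σ K_{n−i} ξ^i` and `∇V_r = (1/σ₁)K_rJ₁∇V₁`, are
constants of motion of the quasi-Hamiltonian system `d(q,p)/dt = (1/σ₁)Π_nc(J₁)dH₁`. -/
theorem bicofactor_constants_of_motion
    (n : ℕ) (U : Set (Fin n → ℝ)) (hU : IsOpen U)
    (g : (Fin n → ℝ) → Matrix (Fin n) (Fin n) ℝ)
    (hg : ∀ i j, ContDiffOn ℝ (⊤ : ℕ∞) (fun q => g q i j) U)
    (hgsym : ∀ q ∈ U, (g q).IsSymm) (hginv : ∀ q ∈ U, IsUnit (g q).det)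
    (J₁ J₂ : (Fin n → ℝ) → Matrix (Fin n) (Fin n) ℝ)
    (hJ₁ : IsJTensor U g J₁) (hJ₂ : IsJTensor U g J₂)
    (hJ₁ns : ∀ q ∈ U, (J₁ q).det ≠ 0) (hJ₂ns : ∀ q ∈ U, (J₂ q).det ≠ 0)
    (σ₁ : (Fin n → ℝ) → ℝ) (hσ₁ : σ₁ = fun q => (J₁ q).det)
    (V W : (Fin n → ℝ) → ℝ) (hV : ContDiffOn ℝ (⊤ : ℕ∞) V U) (hW : ContDiffOn ℝ (⊤ : ℕ∞) W U)
    -- the bi-cofactor condition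
    (hbi : ∀ q ∈ U,
      ((J₁ q).adjugate)⁻¹ *ᵥ grad g V q = ((J₂ q).adjugate)⁻¹ *ᵥ grad g W q)
    -- the Killing tensors K_r defined by the expansion cof(J₂ + ξJ₁) = Σ_{i=0}^{n-1} K_{n-i} ξ^i
    (K : ℕ → (Fin n → ℝ) → Matrix (Fin n) (Fin n) ℝ)
    (hK : ∀ q ∈ U, ∀ ξ : ℝ,
      (J₂ q + ξ • J₁ q).adjugate = ∑ i ∈ Finset.range n, ξ ^ i • K (n - i) q)
    (hK1 : ∀ q ∈ U, K 1 q = (J₁ q).adjugate)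
    (hKn : ∀ q ∈ U, K n q = (J₂ q).adjugate)
    -- the potentials V_r with V₁ = V and ∇V_r = (1/σ₁) K_r J₁ ∇V₁
    (Vr : ℕ → (Fin n → ℝ) → ℝ) (hVr1 : Vr 1 = V)
    (hVrsmooth : ∀ r ∈ Finset.Icc 1 n, ContDiffOn ℝ (⊤ : ℕ∞) (Vr r) U)
    (hVr : ∀ r ∈ Finset.Icc 1 n, ∀ q ∈ U,
      grad g (Vr r) q = (1 / σ₁ q) • ((K r q * J₁ q) *ᵥ grad g (Vr 1) q))
    -- the Hamiltonians H_r
    (Hr : ℕ → (Fin n → ℝ) → (Fin n → ℝ) → ℝ)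
    (hHr : ∀ r, Hr r = fun q p =>
      (1 / 2) * (p ⬝ᵥ ((K r q * (g q)⁻¹) *ᵥ p)) + Vr r q)
    -- a smooth solution (c, pc) of the system d(q,p)/dt = (1/σ₁) Π_nc(J₁) dH₁ on I
    (I : Set ℝ) (hI : IsOpen I)
    (c pc : ℝ → (Fin n → ℝ))
    (hc : ∀ i, ContDiffOn ℝ (⊤ : ℕ∞) (fun t => c t i) I)
    (hpcsm : ∀ i, ContDiffOn ℝ (⊤ : ℕ∞) (fun t => pc t i) I)
    (hcU : ∀ t ∈ I, c t ∈ U)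
    (hsol : ∀ t ∈ I, ∀ i,
      (deriv (fun s => c s i) t
        = (1 / σ₁ (c t)) * ∑ j, J₁ (c t) i j * pd (fun p' => Hr 1 (c t) p') j (pc t))
      ∧
      (deriv (fun s => pc s i) t
        = (1 / σ₁ (c t)) *
            (- (∑ j, J₁ (c t) j i * pd (fun q' => Hr 1 q' (pc t)) j (c t))
              + ∑ j, Omega J₁ (c t) (pc t) i j * pd (fun p' => Hr 1 (c t) p') j (pc t)))) :
    -- each H_r is constant along the solution
    ∀ r ∈ Finset.Icc 1 n, ∀ t ∈ I,
      deriv (fun s => Hr r (c s) (pc s)) t = 0 := by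
  intro r hr t ht
  have hq := hcU t ht
  have hUq : U ∈ nhds (c t) := hU.mem_nhds hq
  have hIt : I ∈ nhds t := hI.mem_nhds ht
  have hsymm : ∀ᶠ x in nhds (c t), (g x).IsSymm := Filter.eventually_of_mem hUq hgsym
  have hgdet : (g (c t)).det ≠ 0 := (hginv _ hq).ne_zero
  have hgd : DiffEntries g (c t) := fun i j =>
    ((hg i j).contDiffAt hUq).differentiableAt (by simp)
  have hd₁ : DiffEntries J₁ (c t) := fun i j =>
    ((hJ₁.1 i j).contDiffAt hUq).differentiableAt (by simp)
  have hd₂ : DiffEntries J₂ (c t) := fun i j =>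
    ((hJ₂.1 i j).contDiffAt hUq).differentiableAt (by simp)
  have hVd : DifferentiableAt ℝ V (c t) := (hV.contDiffAt hUq).differentiableAt (by simp)
  have hVrd : DifferentiableAt ℝ (Vr r) (c t) :=
    ((hVrsmooth r hr).contDiffAt hUq).differentiableAt (by simp)
  have hdet := hJ₁ns _ hq
  have hGs : ((g (c t))⁻¹)ᵀ = (g (c t))⁻¹ := by
    rw [Matrix.transpose_nonsing_inv, (hgsym _ hq).eq]
  have hJG : J₁ (c t) * (g (c t))⁻¹ = (g (c t))⁻¹ * (J₁ (c t))ᵀ := by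
    rw [← (hJ₁.2.1 _ hq).eq, Matrix.transpose_mul, hGs]
  have hA := adjugate_mul_eq_mul_transpose hJG hdet
  have hAs : ((J₁ (c t)).adjugate * (g (c t))⁻¹).IsSymm := by
    rw [Matrix.IsSymm, Matrix.transpose_mul, hGs, hA]
  obtain ⟨α, hα⟩ := hJ₁.exists_jTensorAt hq
  obtain ⟨hBd, hB, hkill⟩ := cofactor_coefficient_killing hU hgsym hJ₁ hJ₂ hK hq hgd hgdet hd₁ hd₂
    (hJ₂ns _ hq) hr
  have hBs : (K r (c t) * (g (c t))⁻¹).IsSymm := by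
    rw [Matrix.IsSymm, Matrix.transpose_mul, hGs, hB]
  have hHp : ∀ j, pd (fun p' => Hr 1 (c t) p') j (pc t) =
      (((J₁ (c t)).adjugate * (g (c t))⁻¹) *ᵥ pc t) j := by
    intro j
    simp only [hHr, hK1 _ hq]
    exact pd_quadraticForm_momentum hAs _ _ _
  have hHq : ∀ j, pd (fun q' => Hr 1 q' (pc t)) j (c t) =
      (1 / 2) * (pc t ⬝ᵥ (pdMat (fun x => (J₁ x).adjugate * (g x)⁻¹) j (c t) *ᵥ pc t)) +
        pd V j (c t) := by
    intro j
    rw [← pd_quadraticForm_position (hd₁.adjugate.mul (hgd.inv hgdet)) hVd]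
    refine pd_congr (Filter.eventually_of_mem hUq fun x hx => ?_) j
    simp only [hHr, hK1 x hx, hVr1]
  have hc' : HasDerivAt c ((g (c t))⁻¹ *ᵥ pc t) t := by
    rw [hasDerivAt_pi]
    intro i
    refine (((hc i).contDiffAt hIt).differentiableAt (by simp)).hasDerivAt.congr_deriv ?_
    rw [(hsol t ht i).1]
    simp only [hHp, hσ₁]
    change _ * (J₁ (c t) *ᵥ (((J₁ (c t)).adjugate * (g (c t))⁻¹) *ᵥ pc t)) i = _
    rw [Matrix.mulVec_mulVec, ← Matrix.mul_assoc, Matrix.mul_adjugate, Matrix.smul_mul,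
      Matrix.one_mul, Matrix.smul_mulVec, Pi.smul_apply, smul_eq_mul]
    field_simp
  set P' : Fin n → ℝ := (fun i => pc t ⬝ᵥ (christoffelMat g i (c t) *ᵥ ((g (c t))⁻¹ *ᵥ pc t))) -
    (1 / (J₁ (c t)).det) • ((J₁ (c t))ᵀ *ᵥ fun j => pd V j (c t)) with hP'
  have hpc' : HasDerivAt pc P' t := by
    rw [hasDerivAt_pi]
    intro i
    refine (((hpcsm i).contDiffAt hIt).differentiableAt (by simp)).hasDerivAt.congr_deriv ?_
    rw [(hsol t ht i).2]
    have hmom := hα.momentum hd₁ hgd hsymm hgdet hdet hA (pc t) i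
    simp only [hHp, hHq, hσ₁, mul_add, Finset.sum_add_distrib, hP', Pi.sub_apply, Pi.smul_apply,
      Matrix.mulVec, dotProduct, Matrix.transpose_apply, smul_eq_mul] at hmom ⊢
    rw [← mul_add, neg_add, add_right_comm, hmom]
    field_simp
    ring
  have hH := (hasDerivAt_quadraticForm hpc' (N' := Matrix.of fun i j => ∑ h,
      ((g (c t))⁻¹ *ᵥ pc t) h * pdMat (fun x => K r x * (g x)⁻¹) h (c t) i j)
      (fun i j => hasDerivAt_comp_pd (hBd i j) hc') hBs).fun_add (hasDerivAt_comp_pd hVrd hc')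
  simp only [hHr]
  refine (hH.congr_deriv ?_).deriv
  have hN' : (Matrix.of fun i j => ∑ h,
      ((g (c t))⁻¹ *ᵥ pc t) h * pdMat (fun x => K r x * (g x)⁻¹) h (c t) i j) =
      ∑ h, ((g (c t))⁻¹ *ᵥ pc t) h • pdMat (fun x => K r x * (g x)⁻¹) h (c t) := by
    ext i j
    simp [Matrix.sum_apply]
  have hkin : ∑ i, ((K r (c t) * (g (c t))⁻¹) *ᵥ pc t) i *
      (pc t ⬝ᵥ (christoffelMat g i (c t) *ᵥ ((g (c t))⁻¹ *ᵥ pc t))) =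
      (fun i => pc t ⬝ᵥ (christoffelMat g i (c t) *ᵥ ((g (c t))⁻¹ *ᵥ pc t))) ⬝ᵥ
        ((K r (c t) * (g (c t))⁻¹) *ᵥ pc t) := dotProduct_comm _ _
  rw [hN', Matrix.sum_mulVec, dotProduct_sum]
  simp only [Matrix.smul_mulVec, dotProduct_smul, smul_eq_mul]
  rw [hkill, sum_dotProduct_christoffelMat_mulVec_comm hsymm, hkin, hP', sub_dotProduct,
    smul_dotProduct]
  have hpot : ∑ h, ((g (c t))⁻¹ *ᵥ pc t) h * pd (Vr r) h (c t) =
      (1 / (J₁ (c t)).det) • (((J₁ (c t))ᵀ *ᵥ fun j => pd V j (c t)) ⬝ᵥ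
        ((K r (c t) * (g (c t))⁻¹) *ᵥ pc t)) := by
    have e := congrArg (fun u => pc t ⬝ᵥ u) (hVr r hr _ hq)
    simp only [grad, hσ₁, hVr1, dotProduct_smul, Matrix.mulVec_mulVec] at e
    rw [Matrix.mul_assoc, hJG, ← Matrix.mul_assoc, ← Matrix.mulVec_mulVec,
      Matrix.dotProduct_mulVec _ (K r (c t) * _), ← Matrix.mulVec_transpose, hBs.eq,
      dotProduct_comm (_ *ᵥ pc t), Matrix.dotProduct_mulVec, ← Matrix.mulVec_transpose, hGs] at e
    exact e
  rw [hpot]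
  ring
end
end
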